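/- Performance lower bound for the policy optimized in the uncertainty-penalized model (Theorem 1): Let M = (S, A, T, r, μ₀, γ) and M̃ = (S, A, T̃, r, μ₀, γ) be two finite discounted MDPs differing only in their dynamics, and let ũ : S × A → ℝ be an admissible error estimator, i.e. for every stationary stochastic policy π and every (s, a) ∈ S × A, |E_{s'∼T̃(s,a)}[V_M^π(s')] − E_{s'∼T(s,a)}[V_M^π(s')]| ≤ ũ(s, a). Set λ := γ, define the penalized reward r̃(s, a) := r(s, a) − λ·ũ(s, a), the penalized model MDP M̃_r̃ := (S, A, T̃, r̃, μ₀, γ), and the policy-level uncertainty ε_ũ(π) := Ē_{(s,a)∼ρ_{T̃}^π}[ũ(s, a)]. If π̃ is a stationary stochastic policy that is optimal for the penalized model, i.e. η_{M̃_r̃}(π̃) ≥ η_{M̃_r̃}(π) for every stationary stochastic policy π, then η_M(π̃) ≥ η_M(π) − 2λ·ε_ũ(π) for every stationary stochastic policy π; in particular η_M(π̃) ≥ sup_π {η_M(π) − 2λ·ε_ũ(π)}. -/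

import Mathlib

open scoped BigOperators

/-- Expectation of a real-valued function under a `PMF` on a finite type. -/
noncomputable def pmfExp {X : Type*} [Fintype X] (d : PMF X) (f : X → ℝ) : ℝ :=
  ∑ x, (d x).toReal * f x

/-- Initial state–action distribution: `s ∼ μ`, `a ∼ π s`. -/
noncomputable def initSA {S A : Type*} (π : S → PMF A) (μ : PMF S) : PMF (S × A) :=
  μ.bind fun s => (π s).map fun a => (s, a)

/-- One step of the state–action Markov chain induced by dynamics `T` and policy `π`. -/
noncomputable def stepSA {S A : Type*} (T : S → A → PMF S) (π : S → PMF A)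
    (d : PMF (S × A)) : PMF (S × A) :=
  d.bind fun sa => (T sa.1 sa.2).bind fun s' => (π s').map fun a' => (s', a')

/-- Distribution of the time-`t` state–action pair of the chain started from `μ`. -/
noncomputable def saDist {S A : Type*} (T : S → A → PMF S) (π : S → PMF A)
    (μ : PMF S) : ℕ → PMF (S × A)
  | 0 => initSA π μ
  | (t + 1) => stepSA T π (saDist T π μ t)

/-- Unnormalized discounted occupancy expectation
`Ē_{(s,a)∼ρ_T^π}[f] = Σ_t γ^t E[f(s_t,a_t)]`, chain started from `μ`. -/
noncomputable def occExp {S A : Type*} [Fintype S] [Fintype A]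
    (T : S → A → PMF S) (π : S → PMF A) (μ : PMF S) (γ : ℝ) (f : S × A → ℝ) : ℝ :=
  ∑' t : ℕ, γ ^ t * pmfExp (saDist T π μ t) f

/-- Value function `V_M^π(s)` of the MDP with dynamics `T`, reward `r`, discount `γ`. -/
noncomputable def valueFun {S A : Type*} [Fintype S] [Fintype A]
    (T : S → A → PMF S) (π : S → PMF A) (r : S × A → ℝ) (γ : ℝ) (s : S) : ℝ :=
  occExp T π (PMF.pure s) γ r

/-- Expected return `η_M(π) = E_{s∼μ₀}[V_M^π(s)]`. -/
noncomputable def expReturn {S A : Type*} [Fintype S] [Fintype A]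
    (T : S → A → PMF S) (π : S → PMF A) (r : S × A → ℝ) (γ : ℝ) (μ : PMF S) : ℝ :=
  ∑ s, (μ s).toReal * valueFun T π r γ s

/-- Model-error gap `G_{M̃}^π(s,a) = E_{s'∼T̃(s,a)}[V_M^π(s')] − E_{s'∼T(s,a)}[V_M^π(s')]`,
where `T` is the true dynamics and `T'` the model dynamics. -/
noncomputable def Ggap {S A : Type*} [Fintype S] [Fintype A]
    (T T' : S → A → PMF S) (π : S → PMF A) (r : S × A → ℝ) (γ : ℝ) (sa : S × A) : ℝ :=
  (∑ s', ((T' sa.1 sa.2) s').toReal * valueFun T π r γ s') -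
    (∑ s', ((T sa.1 sa.2) s').toReal * valueFun T π r γ s')

section
variable {X Y S A : Type*} [Fintype X] [Fintype Y] [Fintype S] [Fintype A]

lemma pmfExp_bind (d : PMF X) (k : X → PMF Y) (f : Y → ℝ) :
    pmfExp (d.bind k) f = pmfExp d fun x => pmfExp (k x) f := by
  have h : ∀ y, ((d.bind k) y).toReal = ∑ x, (d x).toReal * (k x y).toReal := fun y => by
    rw [PMF.bind_apply, tsum_fintype, ENNReal.toReal_sum
      fun x _ => ENNReal.mul_ne_top (d.apply_ne_top x) ((k x).apply_ne_top y)]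
    simp only [ENNReal.toReal_mul]
  simp only [pmfExp, h, Finset.sum_mul, Finset.mul_sum, mul_assoc]
  exact Finset.sum_comm

lemma pmfExp_pure (x : X) (f : X → ℝ) : pmfExp (PMF.pure x) f = f x := by
  classical
  rw [pmfExp, Finset.sum_eq_single x] <;> simp +contextual [PMF.pure_apply]

lemma pmfExp_map (d : PMF X) (g : X → Y) (f : Y → ℝ) :
    pmfExp (d.map g) f = pmfExp d fun x => f (g x) := by
  simp only [← PMF.bind_pure_comp, pmfExp_bind, Function.comp_apply, pmfExp_pure]

lemma sum_toReal_eq_one (d : PMF X) : ∑ x, (d x).toReal = 1 := by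
  rw [← ENNReal.toReal_sum fun x _ => d.apply_ne_top x, ← tsum_fintype (L := .unconditional X),
    d.tsum_coe, ENNReal.toReal_one]

lemma pmfExp_add (d : PMF X) (f g : X → ℝ) :
    pmfExp d (fun x => f x + g x) = pmfExp d f + pmfExp d g := by
  simp only [pmfExp, mul_add, Finset.sum_add_distrib]

lemma pmfExp_const_mul (d : PMF X) (c : ℝ) (f : X → ℝ) :
    pmfExp d (fun x => c * f x) = c * pmfExp d f := by
  simp only [pmfExp, Finset.mul_sum, mul_left_comm]

lemma pmfExp_const (d : PMF X) (c : ℝ) : pmfExp d (fun _ => c) = c := by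
  rw [pmfExp, ← Finset.sum_mul, sum_toReal_eq_one, one_mul]

lemma pmfExp_mono (d : PMF X) {f g : X → ℝ} (h : ∀ x, f x ≤ g x) : pmfExp d f ≤ pmfExp d g :=
  Finset.sum_le_sum fun x _ => mul_le_mul_of_nonneg_left (h x) ENNReal.toReal_nonneg

lemma abs_pmfExp_le (d : PMF X) (f : X → ℝ) : |pmfExp d f| ≤ ∑ x, |f x| := by
  have hf : ∀ x, |f x| ≤ ∑ x, |f x| := fun x =>
    Finset.single_le_sum (fun y _ => abs_nonneg (f y)) (Finset.mem_univ x)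
  rw [abs_le]
  constructor
  · rw [← pmfExp_const d (-∑ x, |f x|)]
    exact pmfExp_mono d fun x => (abs_le.1 (hf x)).1
  · rw [← pmfExp_const d (∑ x, |f x|)]
    exact pmfExp_mono d fun x => (abs_le.1 (hf x)).2

lemma summable_pow_mul_pmfExp {γ : ℝ} (hγ0 : 0 ≤ γ) (hγ1 : γ < 1) (d : ℕ → PMF X) (f : X → ℝ) :
    Summable fun t => γ ^ t * pmfExp (d t) f := by
  refine Summable.of_norm_bounded
    ((summable_geometric_of_lt_one hγ0 hγ1).mul_right (∑ x, |f x|)) fun t => ?_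
  rw [Real.norm_eq_abs, abs_mul, abs_of_nonneg (pow_nonneg hγ0 t)]
  exact mul_le_mul_of_nonneg_left (abs_pmfExp_le _ _) (pow_nonneg hγ0 t)

/-- The distribution of the next state when the current state has distribution `μ`. -/
noncomputable def nextState {S A : Type*} (T : S → A → PMF S) (π : S → PMF A) (μ : PMF S) : PMF S :=
  μ.bind fun s => (π s).bind fun a => T s a

lemma saDist_succ_eq_nextState {S A : Type*} (T : S → A → PMF S) (π : S → PMF A) (μ : PMF S)
    (t : ℕ) : saDist T π μ (t + 1) = saDist T π (nextState T π μ) t := by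
  induction t with
  | zero => simp [saDist, stepSA, initSA, nextState, PMF.bind_bind, PMF.bind_map, Function.comp_def]
  | succ t ih =>
    rw [saDist, ih]
    rfl

lemma pmfExp_initSA (π : S → PMF A) (μ : PMF S) (f : S × A → ℝ) :
    pmfExp (initSA π μ) f = pmfExp μ fun s => pmfExp (π s) fun a => f (s, a) := by
  simp only [initSA, pmfExp_bind, pmfExp_map]

lemma pmfExp_saDist (T : S → A → PMF S) (π : S → PMF A) (μ : PMF S) (t : ℕ) (f : S × A → ℝ) :
    pmfExp (saDist T π μ t) f = pmfExp μ fun s => pmfExp (saDist T π (PMF.pure s) t) f := by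
  induction t generalizing f with
  | zero => simp only [saDist, pmfExp_initSA, pmfExp_pure]
  | succ t ih => simp only [saDist, stepSA, pmfExp_bind]; exact ih _

section Discounted
variable {γ : ℝ}

lemma occExp_eq_pmfExp_valueFun (hγ0 : 0 ≤ γ) (hγ1 : γ < 1) (T : S → A → PMF S) (π : S → PMF A)
    (μ : PMF S) (f : S × A → ℝ) :
    occExp T π μ γ f = pmfExp μ (valueFun T π f γ) := by
  have h : ∀ s, HasSum (fun t => (μ s).toReal * (γ ^ t * pmfExp (saDist T π (PMF.pure s) t) f))
      ((μ s).toReal * valueFun T π f γ s) := fun s =>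
    (summable_pow_mul_pmfExp hγ0 hγ1 _ f).hasSum.mul_left _
  refine HasSum.tsum_eq ?_
  rw [pmfExp]
  convert hasSum_sum (s := Finset.univ) fun s _ => h s using 2 with t
  rw [pmfExp_saDist, ← pmfExp_const_mul, pmfExp]

lemma expReturn_eq_occExp (hγ0 : 0 ≤ γ) (hγ1 : γ < 1) (T : S → A → PMF S) (π : S → PMF A)
    (f : S × A → ℝ) (μ : PMF S) :
    expReturn T π f γ μ = occExp T π μ γ f :=
  (occExp_eq_pmfExp_valueFun hγ0 hγ1 T π μ f).symm

lemma occExp_eq_add_nextState (hγ0 : 0 ≤ γ) (hγ1 : γ < 1) (T : S → A → PMF S) (π : S → PMF A)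
    (μ : PMF S) (f : S × A → ℝ) :
    occExp T π μ γ f = pmfExp (initSA π μ) f + γ * occExp T π (nextState T π μ) γ f := by
  rw [occExp, (summable_pow_mul_pmfExp hγ0 hγ1 _ f).tsum_eq_zero_add, occExp, ← tsum_mul_left]
  simp only [saDist_succ_eq_nextState, pow_zero, one_mul, pow_succ', mul_assoc]
  rfl

/-- The Bellman equation. -/
lemma valueFun_eq (hγ0 : 0 ≤ γ) (hγ1 : γ < 1) (T : S → A → PMF S) (π : S → PMF A)
    (f : S × A → ℝ) (s : S) :
    valueFun T π f γ s =
      pmfExp (π s) fun a => f (s, a) + γ * pmfExp (T s a) (valueFun T π f γ) := by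
  rw [valueFun, occExp_eq_add_nextState hγ0 hγ1, occExp_eq_pmfExp_valueFun hγ0 hγ1, pmfExp_initSA,
    pmfExp_pure, nextState, PMF.pure_bind, pmfExp_bind, pmfExp_add, pmfExp_const_mul]

lemma occExp_add (hγ0 : 0 ≤ γ) (hγ1 : γ < 1) (T : S → A → PMF S) (π : S → PMF A) (μ : PMF S)
    (f g : S × A → ℝ) :
    occExp T π μ γ (fun x => f x + g x) = occExp T π μ γ f + occExp T π μ γ g := by
  simp only [occExp, pmfExp_add, mul_add]
  exact (summable_pow_mul_pmfExp hγ0 hγ1 _ f).tsum_add (summable_pow_mul_pmfExp hγ0 hγ1 _ g)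

lemma occExp_const_mul (T : S → A → PMF S) (π : S → PMF A) (μ : PMF S) (c : ℝ) (f : S × A → ℝ) :
    occExp T π μ γ (fun x => c * f x) = c * occExp T π μ γ f := by
  simp only [occExp, pmfExp_const_mul, ← tsum_mul_left, mul_left_comm]

lemma occExp_mono (hγ0 : 0 ≤ γ) (hγ1 : γ < 1) (T : S → A → PMF S) (π : S → PMF A) (μ : PMF S)
    {f g : S × A → ℝ} (h : ∀ x, f x ≤ g x) : occExp T π μ γ f ≤ occExp T π μ γ g :=
  (summable_pow_mul_pmfExp hγ0 hγ1 _ f).tsum_le_tsum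
    (fun _ => mul_le_mul_of_nonneg_left (pmfExp_mono _ h) (pow_nonneg hγ0 _))
    (summable_pow_mul_pmfExp hγ0 hγ1 _ g)

/-- If `h` is the one-step decrement of `V` along the chain, its discounted sum telescopes. -/
lemma occExp_eq_of_telescope (hγ0 : 0 ≤ γ) (hγ1 : γ < 1) (T : S → A → PMF S) (π : S → PMF A)
    (V : S → ℝ) (h : S × A → ℝ)
    (hV : ∀ s, V s = pmfExp (π s) fun a => h (s, a) + γ * pmfExp (T s a) V) (μ : PMF S) :
    occExp T π μ γ h = pmfExp μ V := by
  have step (μ : PMF S) : pmfExp μ V = pmfExp (initSA π μ) h + γ * pmfExp (nextState T π μ) V := by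
    rw [pmfExp_initSA, nextState, pmfExp_bind, ← pmfExp_const_mul, ← pmfExp_add]
    congr 1
    funext s
    rw [hV s, pmfExp_bind, ← pmfExp_const_mul, pmfExp_add]
  have bound (n : ℕ) : ∀ μ : PMF S,
      |occExp T π μ γ h - pmfExp μ V| ≤ γ ^ n * ∑ s, |valueFun T π h γ s + -1 * V s| := by
    induction n with
    | zero =>
      intro μ
      rw [occExp_eq_pmfExp_valueFun hγ0 hγ1, pow_zero, one_mul, sub_eq_add_neg, neg_eq_neg_one_mul,
        ← pmfExp_const_mul, ← pmfExp_add]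
      exact abs_pmfExp_le _ _
    | succ n ih =>
      intro μ
      rw [occExp_eq_add_nextState hγ0 hγ1, step μ, add_sub_add_left_eq_sub, ← mul_sub, abs_mul,
        abs_of_nonneg hγ0, pow_succ', mul_assoc]
      exact mul_le_mul_of_nonneg_left (ih _) hγ0
  have lim := (tendsto_pow_atTop_nhds_zero_of_lt_one hγ0 hγ1).mul_const
    (∑ s, |valueFun T π h γ s + -1 * V s|)
  rw [zero_mul] at lim
  exact sub_eq_zero.1 (abs_nonpos_iff.1 (ge_of_tendsto' lim fun n => bound n μ))

/-- The telescoping (simulation) lemma. -/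
lemma occExp_eq_add_occExp_Ggap (hγ0 : 0 ≤ γ) (hγ1 : γ < 1) (T T' : S → A → PMF S)
    (π : S → PMF A) (r : S × A → ℝ) (μ : PMF S) :
    occExp T' π μ γ r = expReturn T π r γ μ + γ * occExp T' π μ γ (Ggap T T' π r γ) := by
  have key := occExp_eq_of_telescope hγ0 hγ1 T' π (valueFun T π r γ)
    (fun x => r x + -γ * Ggap T T' π r γ x) (fun s => by
      rw [valueFun_eq hγ0 hγ1]
      congr 1
      funext a
      simp only [Ggap, pmfExp]
      ring) μ
  rw [occExp_add hγ0 hγ1, occExp_const_mul] at key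
  have e : expReturn T π r γ μ = pmfExp μ (valueFun T π r γ) := rfl
  linarith

end Discounted
end

/-- **Performance lower bound for the policy optimized in the uncertainty-penalized
model (Theorem 1).** If `ũ` is an admissible error estimator, `λ := γ`,
`r̃(s,a) := r(s,a) − λ·ũ(s,a)`, `ε_ũ(π) := Ē_{(s,a)∼ρ_{T̃}^π}[ũ(s,a)]`, and `π̃` is optimal
for the penalized model MDP `M̃_r̃`, then `η_M(π̃) ≥ η_M(π) − 2λ·ε_ũ(π)` for every policy
`π`; in particular `η_M(π̃) ≥ sup_π {η_M(π) − 2λ·ε_ũ(π)}`. -/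
theorem semopo_performance_lower_bound
    {S A : Type*} [Fintype S] [Fintype A] [Nonempty S] [Nonempty A]
    (T T' : S → A → PMF S) (r : S × A → ℝ) (μ₀ : PMF S) (γ : ℝ)
    (hγ0 : 0 ≤ γ) (hγ1 : γ < 1) (u : S × A → ℝ)
    (hu : ∀ (π : S → PMF A) (s : S) (a : A),
      |(∑ s', ((T' s a) s').toReal * valueFun T π r γ s') -
        (∑ s', ((T s a) s').toReal * valueFun T π r γ s')| ≤ u (s, a))
    (πopt : S → PMF A)
    (hopt : ∀ π : S → PMF A,
      expReturn T' πopt (fun sa => r sa - γ * u sa) γ μ₀ ≥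
        expReturn T' π (fun sa => r sa - γ * u sa) γ μ₀) :
    (∀ π : S → PMF A,
      expReturn T πopt r γ μ₀ ≥
        expReturn T π r γ μ₀ - 2 * γ * occExp T' π μ₀ γ u) ∧
    expReturn T πopt r γ μ₀ ≥
      ⨆ π : S → PMF A, (expReturn T π r γ μ₀ - 2 * γ * occExp T' π μ₀ γ u) := by
  have pen (π : S → PMF A) : expReturn T' π (fun sa => r sa - γ * u sa) γ μ₀ =
      occExp T' π μ₀ γ r - γ * occExp T' π μ₀ γ u := by
    rw [expReturn_eq_occExp hγ0 hγ1]
    simp only [sub_eq_add_neg, ← neg_mul]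
    rw [occExp_add hγ0 hγ1, occExp_const_mul]
  have upper (π : S → PMF A) : occExp T' π μ₀ γ (Ggap T T' π r γ) ≤ occExp T' π μ₀ γ u :=
    occExp_mono hγ0 hγ1 T' π μ₀ fun x => (abs_le.1 (hu π x.1 x.2)).2
  have lower (π : S → PMF A) : -1 * occExp T' π μ₀ γ u ≤ occExp T' π μ₀ γ (Ggap T T' π r γ) := by
    rw [← occExp_const_mul]
    refine occExp_mono hγ0 hγ1 T' π μ₀ fun x => ?_
    rw [neg_one_mul]
    exact (abs_le.1 (hu π x.1 x.2)).1
  have main (π : S → PMF A) : expReturn T π r γ μ₀ - 2 * γ * occExp T' π μ₀ γ u ≤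
      expReturn T πopt r γ μ₀ := by
    have h := hopt π
    rw [pen, pen, occExp_eq_add_occExp_Ggap hγ0 hγ1 T T' π,
      occExp_eq_add_occExp_Ggap hγ0 hγ1 T T' πopt] at h
    have h1 := mul_le_mul_of_nonneg_left (upper πopt) hγ0
    have h2 := mul_le_mul_of_nonneg_left (lower π) hγ0
    linarith
  have : Nonempty (S → PMF A) := ⟨fun _ => PMF.pure (Classical.arbitrary A)⟩
  exact ⟨main, ciSup_le main⟩
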